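/- Let σ be a polyhedral embedding of a graph G and let C = (v_1, …, v_k) be a directed simple induced cycle of G. Then either C is a facial walk of σ or at least 3 vertices of C are tails of darts left of C; symmetrically, either the reversed cycle C⁻¹ is a facial walk of σ or at least 3 vertices of C are tails of darts right of C. If moreover G is cubic and neither C nor C⁻¹ is a facial walk, then C has at least 2 left facial subpaths and at least 2 right facial subpaths. -/

import Mathlib

open SimpleGraph

/-- A graph is cubic if every vertex has degree `3`. -/
def SimpleGraph.IsCubic {V : Type*} (G : SimpleGraph V) : Prop :=
  ∀ v : V, Nat.card (G.neighborSet v) = 3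

/-- A combinatorial (orientable) embedding of a graph `G`, given as a rotation system:
a permutation of the darts of `G` whose orbits are exactly the sets of darts
sharing a common tail. -/
structure RotationSystem {V : Type*} [Fintype V] [DecidableEq V] (G : SimpleGraph V) where
  σ : Equiv.Perm G.Dart
  tail_fixed : ∀ d : G.Dart, (σ d).fst = d.fst
  orbit_tail : ∀ d d' : G.Dart, d.fst = d'.fst → σ.SameCycle d d'

namespace RotationSystem

variable {V : Type*} [Fintype V] [DecidableEq V] {G : SimpleGraph V}

/-- The involutive permutation of darts reversing the orientation. -/
def dartSymmPerm (G : SimpleGraph V) : Equiv.Perm G.Dart :=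
  ⟨SimpleGraph.Dart.symm, SimpleGraph.Dart.symm,
    fun d => d.symm_symm, fun d => d.symm_symm⟩

/-- The permutation sending a dart `d` to `σ (d⁻¹)`; its orbits are the faces
of the embedding. -/
def faceMap (R : RotationSystem G) : Equiv.Perm G.Dart :=
  (dartSymmPerm G).trans R.σ

/-- Two darts lie on the same face iff they are in the same orbit of the face map. -/
def SameFace (R : RotationSystem G) : G.Dart → G.Dart → Prop :=
  (R.faceMap).SameCycle

/-- The set of vertices of the face (of the embedding `R`) containing the dart `d`. -/
def faceVerts (R : RotationSystem G) (d : G.Dart) : Set V :=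
  {v | ∃ d' : G.Dart, R.SameFace d d' ∧ d'.fst = v}

/-- The set of edges of the face (of the embedding `R`) containing the dart `d`. -/
def faceEdges (R : RotationSystem G) (d : G.Dart) : Set (Sym2 V) :=
  {e | ∃ d' : G.Dart, R.SameFace d d' ∧ d'.edge = e}

/-- Every facial walk of the embedding is a simple cycle, i.e. no facial walk
visits a vertex twice. -/
def FacesSimple (R : RotationSystem G) : Prop :=
  ∀ d d' : G.Dart, R.SameFace d d' → d.fst = d'.fst → d = d'

/-- An embedding is polyhedral if every facial walk is a simple cycle and the
intersection of any two distinct faces (as subgraphs) is empty, a single vertex,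
or a single edge. -/
def Polyhedral (R : RotationSystem G) : Prop :=
  R.FacesSimple ∧
  ∀ d d' : G.Dart, ¬ R.SameFace d d' →
    (R.faceVerts d ∩ R.faceVerts d' = ∅) ∨
    (∃ v : V, R.faceVerts d ∩ R.faceVerts d' = {v} ∧
      R.faceEdges d ∩ R.faceEdges d' = ∅) ∨
    (∃ u w : V, G.Adj u w ∧ R.faceVerts d ∩ R.faceVerts d' = {u, w} ∧
      R.faceEdges d ∩ R.faceEdges d' = {s(u, w)})

/-- The number of faces of the embedding. -/
noncomputable def numFaces (R : RotationSystem G) : ℕ :=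
  Nat.card (Quot R.SameFace)

/-- The embedding has genus `g`, defined via Euler's formula
`|V| - |E| + F = 2 - 2g`. -/
def HasGenus (R : RotationSystem G) (g : ℕ) : Prop :=
  (Fintype.card V : ℤ) - Nat.card G.edgeSet + R.numFaces = 2 - 2 * (g : ℤ)

end RotationSystem

/-- A directed simple cycle of length `k` in `G`: a cyclic sequence of darts,
each ending where the next one starts, with pairwise distinct tails. -/
structure DirCycle {V : Type*} (G : SimpleGraph V) (k : ℕ) where
  darts : ZMod k → G.Dart
  chain : ∀ i : ZMod k, (darts i).snd = (darts (i + 1)).fst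
  inj : Function.Injective fun i : ZMod k => (darts i).fst

namespace DirCycle

variable {V : Type*} {G : SimpleGraph V} {k : ℕ}

/-- The vertex set of a directed cycle. -/
def vertices (c : DirCycle G k) : Set V :=
  Set.range fun i : ZMod k => (c.darts i).fst

/-- The edge set of a directed cycle. -/
def edges (c : DirCycle G k) : Set (Sym2 V) :=
  Set.range fun i : ZMod k => (c.darts i).edge

/-- A cycle is induced if every edge of `G` with both endpoints on the cycle is
an edge of the cycle. -/
def Induced (c : DirCycle G k) : Prop :=
  ∀ u w : V, G.Adj u w → u ∈ c.vertices → w ∈ c.vertices → s(u, w) ∈ c.edges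

end DirCycle

namespace RotationSystem

variable {V : Type*} [Fintype V] [DecidableEq V] {G : SimpleGraph V} {k : ℕ}

/-- The directed cycle `C` is a facial walk of the embedding. -/
def IsFaceOf (R : RotationSystem G) (c : DirCycle G k) : Prop :=
  ∀ i : ZMod k, R.faceMap (c.darts i) = c.darts (i + 1)

/-- The reversed directed cycle `C⁻¹` is a facial walk of the embedding. -/
def IsReverseFaceOf (R : RotationSystem G) (c : DirCycle G k) : Prop :=
  ∀ i : ZMod k, R.faceMap ((c.darts (i + 1)).symm) = (c.darts i).symm

/-- The (undirected) cycle underlying `C` is a facial cycle: one of its two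
orientations is a facial walk. -/
def IsFacialCycle (R : RotationSystem G) (c : DirCycle G k) : Prop :=
  R.IsFaceOf c ∨ R.IsReverseFaceOf c

/-- In the cyclic order obtained by iterating `σ` from `b`, the element `x` occurs
(strictly after `b`) before `y` occurs. -/
def OccursBefore (σ : Equiv.Perm G.Dart) (b x y : G.Dart) : Prop :=
  ∃ m : ℕ, 0 < m ∧ (σ ^ m) b = x ∧ ∀ l : ℕ, 0 < l → l ≤ m → (σ ^ l) b ≠ y

/-- The dart `e`, with tail the `i`-th vertex of the directed cycle `c` and not one
of the two darts of `c` at that vertex, leaves `c` to the right: in the rotation at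
the `i`-th vertex it occurs after the outgoing cycle dart and before the inverse of
the incoming cycle dart. -/
def IsRightDartAt (R : RotationSystem G) (c : DirCycle G k) (i : ZMod k) (e : G.Dart) : Prop :=
  e.fst = (c.darts i).fst ∧ e ≠ c.darts i ∧ e ≠ (c.darts (i - 1)).symm ∧
    OccursBefore R.σ (c.darts i) e ((c.darts (i - 1)).symm)

/-- The dart `e`, with tail the `i`-th vertex of the directed cycle `c` and not one
of the two darts of `c` at that vertex, leaves `c` to the left. -/
def IsLeftDartAt (R : RotationSystem G) (c : DirCycle G k) (i : ZMod k) (e : G.Dart) : Prop :=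
  e.fst = (c.darts i).fst ∧ e ≠ c.darts i ∧ e ≠ (c.darts (i - 1)).symm ∧
    ¬ OccursBefore R.σ (c.darts i) e ((c.darts (i - 1)).symm)

/-- Position `i + 1` starts a maximal run of vertices of `c` having no dart leaving
`c` to the left; each such run corresponds to one left facial subpath of `c`. -/
def LeftSubpathStart (R : RotationSystem G) (c : DirCycle G k) (i : ZMod k) : Prop :=
  (∃ e : G.Dart, R.IsLeftDartAt c i e) ∧ ¬ ∃ e : G.Dart, R.IsLeftDartAt c (i + 1) e

/-- Position `i + 1` starts a maximal run of vertices of `c` having no dart leaving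
`c` to the right; each such run corresponds to one right facial subpath of `c`. -/
def RightSubpathStart (R : RotationSystem G) (c : DirCycle G k) (i : ZMod k) : Prop :=
  (∃ e : G.Dart, R.IsRightDartAt c i e) ∧ ¬ ∃ e : G.Dart, R.IsRightDartAt c (i + 1) e

end RotationSystem


namespace RotationSystem

section helpers

variable {V : Type*} [Fintype V] [DecidableEq V] {G : SimpleGraph V} {k : ℕ}

theorem zmod_ne_two (hk : 3 ≤ k) (i : ZMod k) : i + 1 + 1 ≠ i := by
  intro h
  have h2 : ((2 : ℕ) : ZMod k) = 0 := by
    push_cast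
    linear_combination h
  rw [ZMod.natCast_eq_zero_iff] at h2
  have := Nat.le_of_dvd (by norm_num) h2
  omega

theorem cyc_ne_symm (hk : 3 ≤ k) (c : DirCycle G k) (i j : ZMod k) :
    c.darts i ≠ (c.darts j).symm := by
  intro h
  have h1 : (c.darts i).fst = (c.darts (j + 1)).fst := by
    rw [h, ← c.chain j]; rfl
  have h2 : (c.darts (i + 1)).fst = (c.darts j).fst := by
    rw [← c.chain i, h]; rfl
  have e1 := c.inj h1
  have e2 := c.inj h2
  subst e1
  exact zmod_ne_two hk _ e2

theorem cyc_inj (c : DirCycle G k) {i j : ZMod k} (h : c.darts i = c.darts j) : i = j :=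
  c.inj (by simp [h])

theorem faceMap_apply (R : RotationSystem G) (d : G.Dart) : R.faceMap d = R.σ d.symm := rfl

theorem faceMap_fst (R : RotationSystem G) (d : G.Dart) : (R.faceMap d).fst = d.snd := by
  rw [faceMap_apply, R.tail_fixed]; rfl

theorem sigma_ne_self (R : RotationSystem G) {a b : G.Dart} (h : a.fst = b.fst) (hab : a ≠ b) :
    R.σ a ≠ a := by
  intro hs
  obtain ⟨n, hn⟩ := R.orbit_tail a b h
  apply hab
  rw [← hn]
  exact ((Function.IsFixedPt.perm_zpow (e := R.σ) hs n)).symm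

theorem pred_fst (c : DirCycle G k) (i : ZMod k) :
    (c.darts i).fst = (c.darts (i - 1)).symm.fst := by
  have := c.chain (i - 1)
  rw [sub_add_cancel] at this
  exact this.symm

theorem left_iff (R : RotationSystem G) (hk : 3 ≤ k) (c : DirCycle G k) (i : ZMod k) :
    (∃ e, R.IsLeftDartAt c i e) ↔ R.faceMap (c.darts (i - 1)) ≠ c.darts i := by
  have hab := cyc_ne_symm hk c i (i - 1)
  have hf := pred_fst c i
  rw [faceMap_apply]
  unfold IsLeftDartAt
  generalize c.darts i = a at *
  generalize (c.darts (i - 1)).symm = b at *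
  constructor
  · rintro ⟨e, he, hea, heb, hno⟩ hs
    apply hno
    haveI : Finite G.Dart :=
      Finite.of_injective (fun d : G.Dart => d.toProd) (fun _ _ h => SimpleGraph.Dart.ext _ _ h)
    obtain ⟨m, hm⟩ := (R.orbit_tail a e he.symm).exists_nat_pow_eq
    have hex : ∃ m : ℕ, (R.σ ^ m) a = e := ⟨m, hm⟩
    classical
    refine ⟨Nat.find hex, ?_, Nat.find_spec hex, ?_⟩
    · rcases Nat.eq_zero_or_pos (Nat.find hex) with h0 | h0
      · have := Nat.find_spec hex
        rw [h0] at this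
        exact absurd this.symm hea
      · exact h0
    · intro l hl hlm hlb
      have hspec := Nat.find_spec hex
      rcases hlm.eq_or_lt with h1 | h1
      · rw [← h1, hlb] at hspec
        exact heb hspec.symm
      · have hper : (R.σ ^ (l + 1)) a = a := by
          rw [pow_succ', Equiv.Perm.mul_apply, hlb, hs]
        have h3 : (R.σ ^ (Nat.find hex - (l + 1))) a = e := by
          have h4 := congrArg (R.σ ^ (Nat.find hex - (l + 1))) hper
          rw [← Equiv.Perm.mul_apply, ← pow_add, Nat.sub_add_cancel h1, hspec] at h4
          exact h4.symm
        exact Nat.find_min hex (by omega) h3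
  · intro hs
    refine ⟨R.σ b, ?_, hs, ?_, ?_⟩
    · rw [R.tail_fixed, hf]
    · exact sigma_ne_self R hf.symm hab.symm
    · rintro ⟨m, hm, h1, h2⟩
      obtain ⟨m, rfl⟩ : ∃ m', m = m' + 1 := ⟨m - 1, by omega⟩
      rw [pow_succ', Equiv.Perm.mul_apply] at h1
      have h3 := R.σ.injective h1
      rcases Nat.eq_zero_or_pos m with h0 | h0
      · subst h0
        exact hab h3
      · exact h2 m h0 (by omega) h3

theorem right_iff (R : RotationSystem G) (hk : 3 ≤ k) (c : DirCycle G k) (i : ZMod k) :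
    (∃ e, R.IsRightDartAt c i e) ↔ R.faceMap (c.darts i).symm ≠ (c.darts (i - 1)).symm := by
  have hab := cyc_ne_symm hk c i (i - 1)
  have hf := pred_fst c i
  rw [faceMap_apply, SimpleGraph.Dart.symm_symm]
  unfold IsRightDartAt
  generalize c.darts i = a at *
  generalize (c.darts (i - 1)).symm = b at *
  constructor
  · rintro ⟨e, he, hea, heb, m, hm, h1, h2⟩ hs
    exact h2 1 one_pos hm (by simpa using hs)
  · intro hs
    refine ⟨R.σ a, R.tail_fixed a, sigma_ne_self R hf hab, hs, 1, one_pos, by simp, ?_⟩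
    intro l h1 h2
    obtain rfl : l = 1 := by omega
    simpa using hs

/-- consecutive darts along a face chain are on the same face -/
theorem chain_sameFace (R : RotationSystem G) (c : DirCycle G k) (i : ZMod k) (a b : ℕ)
    (hab : a ≤ b)
    (h : ∀ m, a ≤ m → m < b →
      R.faceMap (c.darts (i + (m : ℕ))) = c.darts (i + ((m + 1 : ℕ) : ZMod k))) :
    R.SameFace (c.darts (i + (a : ℕ))) (c.darts (i + (b : ℕ))) := by
  induction b, hab using Nat.le_induction with
  | base => exact Equiv.Perm.SameCycle.refl _ _
  | succ b hb ih =>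
    have h1 := ih (fun m h1 h2 => h m h1 (by omega))
    rw [← h b hb (by omega)]
    exact Equiv.Perm.sameCycle_apply_right.2 h1

theorem chain_sameFace_rev (R : RotationSystem G) (c : DirCycle G k) (i : ZMod k) (a b : ℕ)
    (hab : a ≤ b)
    (h : ∀ m, a ≤ m → m < b →
      R.faceMap (c.darts (i + ((m + 1 : ℕ) : ZMod k))).symm = (c.darts (i + (m : ℕ))).symm) :
    R.SameFace (c.darts (i + (a : ℕ))).symm (c.darts (i + (b : ℕ))).symm := by
  induction b, hab using Nat.le_induction with
  | base => exact Equiv.Perm.SameCycle.refl _ _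
  | succ b hb ih =>
    have h1 := ih (fun m h1 h2 => h m h1 (by omega))
    rw [← h b hb (by omega)] at h1
    exact Equiv.Perm.sameCycle_apply_right.1 h1

theorem exists_pair {α : Type*} [Finite α] (P : α → Prop) (hne : ∃ a, P a)
    (h : ¬ 3 ≤ Nat.card {a // P a}) : ∃ i j, P i ∧ ∀ a, P a → a = i ∨ a = j := by
  obtain ⟨i, hi⟩ := hne
  by_cases hj : ∃ j, P j ∧ j ≠ i
  · obtain ⟨j, hj, hji⟩ := hj
    refine ⟨i, j, hi, fun a ha => ?_⟩
    by_contra hcon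
    push Not at hcon
    apply h
    have hinj : Function.Injective
        (![⟨i, hi⟩, ⟨j, hj⟩, ⟨a, ha⟩] : Fin 3 → {a // P a}) := by
      obtain ⟨h1, h2⟩ := hcon
      intro x y hxy
      fin_cases x <;> fin_cases y <;> simp_all
    simpa using Nat.card_le_card_of_injective _ hinj
  · push Not at hj
    exact ⟨i, i, hi, fun a ha => Or.inl (hj a ha)⟩

theorem part_one (R : RotationSystem G) (hR : R.Polyhedral) (hk : 3 ≤ k) (c : DirCycle G k)
    (hc : c.Induced) (hface : ¬ R.IsFaceOf c) :
    3 ≤ Nat.card {i : ZMod k // R.faceMap (c.darts (i - 1)) ≠ c.darts i} := by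
  haveI : NeZero k := ⟨by omega⟩
  by_contra hcard
  have hne : ∃ i, R.faceMap (c.darts (i - 1)) ≠ c.darts i := by
    unfold IsFaceOf at hface
    push Not at hface
    obtain ⟨i, hi⟩ := hface
    exact ⟨i + 1, by simpa using hi⟩
  obtain ⟨i, j, hi, hall⟩ := exists_pair _ hne hcard
  have hstep : ∀ t, t + 1 ≠ i → t + 1 ≠ j → R.faceMap (c.darts t) = c.darts (t + 1) := by
    intro t h1 h2
    by_contra h3
    rcases hall (t + 1) (by simpa using h3) with h | h
    · exact h1 h
    · exact h2 h
  have hne_face : ¬ R.SameFace (c.darts (i - 1)) (c.darts i) := by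
    intro h
    apply hi
    apply hR.1
    · exact Equiv.Perm.sameCycle_apply_left.2 h
    · rw [faceMap_fst, c.chain, sub_add_cancel]
  have hcast : ∀ m : ℕ, ((m + 1 : ℕ) : ZMod k) = (m : ZMod k) + 1 := by
    intro m; push_cast; rfl
  have hneq : ∀ a b : ℕ, a < k → b < k → a ≠ b → (i + (a : ZMod k)) ≠ i + b := by
    intro a b ha hb hab h
    have h2 := add_left_cancel h
    rw [ZMod.natCast_eq_natCast_iff'] at h2
    rw [Nat.mod_eq_of_lt ha, Nat.mod_eq_of_lt hb] at h2
    exact hab h2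
  have hk1 : (i + ((k - 1 : ℕ) : ZMod k)) = i - 1 := by
    rw [Nat.cast_sub (by omega)]; simp [sub_eq_add_neg]
  obtain ⟨n, hnk, hj⟩ : ∃ n : ℕ, n < k ∧ i + (n : ZMod k) = j :=
    ⟨(j - i).val, ZMod.val_lt _, by simp⟩
  have hsecond : R.SameFace (c.darts j) (c.darts (i - 1)) := by
    have := chain_sameFace R c i n (k - 1) (by omega) (fun m h1 h2 => by
      have hA := hneq (m + 1) 0 (by omega) (by omega) (by omega)
      have hB := hneq (m + 1) n (by omega) (by omega) (by omega)
      rw [hcast, ← add_assoc] at hA hB ⊢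
      apply hstep
      · simpa using hA
      · rw [← hj]; exact hB)
    rwa [hj, hk1] at this
  have hij : ¬ R.SameFace (c.darts i) (c.darts j) := fun h =>
    hne_face (h.trans hsecond).symm
  have hneij : i ≠ j := by
    rintro rfl
    exact hij (Equiv.Perm.SameCycle.refl _ _)
  have hn0 : n ≠ 0 := by
    rintro rfl
    apply hneij
    simpa using hj
  have hfirst : R.SameFace (c.darts i) (c.darts (j - 1)) := by
    have := chain_sameFace R c i 0 (n - 1) (by omega) (fun m h1 h2 => by
      have hA := hneq (m + 1) 0 (by omega) (by omega) (by omega)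
      have hB := hneq (m + 1) n (by omega) (by omega) (by omega)
      rw [hcast, ← add_assoc] at hA hB ⊢
      apply hstep
      · simpa using hA
      · rw [← hj]; exact hB)
    have hj1 : i + ((n - 1 : ℕ) : ZMod k) = j - 1 := by
      rw [Nat.cast_sub (by omega), ← hj]; push_cast; ring
    rw [hj1] at this
    simpa using this
  have hvi : (c.darts i).fst ∈ R.faceVerts (c.darts i) ∩ R.faceVerts (c.darts j) :=
    ⟨⟨_, Equiv.Perm.SameCycle.refl _ _, rfl⟩, R.faceMap (c.darts (i - 1)),
      Equiv.Perm.sameCycle_apply_right.2 hsecond, by rw [faceMap_fst, c.chain, sub_add_cancel]⟩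
  have hvj : (c.darts j).fst ∈ R.faceVerts (c.darts i) ∩ R.faceVerts (c.darts j) :=
    ⟨⟨R.faceMap (c.darts (j - 1)),
      Equiv.Perm.sameCycle_apply_right.2 hfirst, by rw [faceMap_fst, c.chain, sub_add_cancel]⟩,
      ⟨_, Equiv.Perm.SameCycle.refl _ _, rfl⟩⟩
  have hvne : (c.darts i).fst ≠ (c.darts j).fst := fun h => hneij (c.inj h)
  -- an edge of the cycle cannot join the two
  have key : ∀ p q : ZMod k, ¬ R.SameFace (c.darts p) (c.darts q) → p + 1 = q →
      (c.darts p).edge ∉ R.faceEdges (c.darts q) := by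
    rintro p q hpq rfl ⟨d, hd, hde⟩
    rcases (SimpleGraph.dart_edge_eq_iff _ _).1 hde with h | h
    · subst h; exact hpq hd.symm
    · have := hR.1 _ _ hd (by rw [h, ← c.chain]; rfl)
      exact cyc_ne_symm hk c _ _ (this.trans h)
  rcases hR.2 _ _ hij with h | ⟨v, h, -⟩ | ⟨u, w, huw, h, he⟩
  · rw [h] at hvi; exact hvi
  · rw [h] at hvi hvj
    exact hvne (hvi.trans hvj.symm)
  · rw [h] at hvi hvj
    have hs : s(u, w) = s((c.darts i).fst, (c.darts j).fst) := by
      rw [Sym2.eq_iff]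
      simp only [Set.mem_insert_iff, Set.mem_singleton_iff] at hvi hvj
      grind
    have hadj : G.Adj (c.darts i).fst (c.darts j).fst := by
      have : s(u, w) ∈ G.edgeSet := huw
      rw [hs] at this
      exact this
    obtain ⟨t, ht⟩ := hc _ _ hadj ⟨i, rfl⟩ ⟨j, rfl⟩
    have hmem : (c.darts t).edge ∈ R.faceEdges (c.darts i) ∩ R.faceEdges (c.darts j) := by
      rw [he, hs]; exact ht
    have ht2 : s((c.darts t).fst, (c.darts (t + 1)).fst) =
        s((c.darts i).fst, (c.darts j).fst) := by
      rw [← c.chain]; exact ht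
    rcases Sym2.eq_iff.1 ht2 with ⟨h1, h2⟩ | ⟨h1, h2⟩
    · obtain rfl := c.inj h1
      exact key _ _ hij (c.inj h2) hmem.2
    · obtain rfl := c.inj h1
      exact key _ _ (fun h => hij h.symm) (c.inj h2) hmem.1

/-- The reversed cycle. -/
def revCycle (c : DirCycle G k) : DirCycle G k where
  darts i := (c.darts (-i)).symm
  chain i := by
    have := c.chain (-(i + 1))
    rw [show -(i + 1) + 1 = -i by ring] at this
    exact this.symm
  inj i j h := by
    have h' : (c.darts (-i)).snd = (c.darts (-j)).snd := h
    rw [c.chain, c.chain] at h'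
    have := c.inj h'
    simpa using this

theorem revCycle_induced (c : DirCycle G k) (hc : c.Induced) : (revCycle c).Induced := by
  have hv : ∀ u, u ∈ (revCycle c).vertices → u ∈ c.vertices := by
    rintro _ ⟨i, rfl⟩
    exact ⟨-i + 1, (c.chain (-i)).symm⟩
  intro u w huw hu hw
  obtain ⟨t, ht⟩ := hc u w huw (hv u hu) (hv w hw)
  refine ⟨-t, ?_⟩
  simp only [revCycle, neg_neg, SimpleGraph.Dart.edge_symm]
  exact ht

theorem part_two (R : RotationSystem G) (hR : R.Polyhedral) (hk : 3 ≤ k) (c : DirCycle G k)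
    (hc : c.Induced) (hface : ¬ R.IsReverseFaceOf c) :
    3 ≤ Nat.card {i : ZMod k // R.faceMap (c.darts i).symm ≠ (c.darts (i - 1)).symm} := by
  have h := part_one R hR hk (revCycle c) (revCycle_induced c hc) (fun h => hface (fun i => by
    have := h (-(i + 1))
    simp only [revCycle] at this
    rwa [neg_neg, show -(-(i + 1) + 1) = i by ring] at this))
  refine h.trans (le_of_eq (Nat.card_congr ((Equiv.subLeft (1 : ZMod k)).subtypeEquiv ?_)))
  intro i
  simp only [revCycle, Equiv.subLeft_apply]
  rw [show -(i - 1) = 1 - i by ring, show (1 - i - 1) = -i by ring]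

theorem core (R : RotationSystem G) (hR : R.Polyhedral) (hk : 3 ≤ k) (c : DirCycle G k)
    (i : ZMod k) (n : ℕ) (hn : 1 ≤ n) (hnk : n < k)
    (hA : ∀ m, m < n → R.faceMap (c.darts (i + (m : ℕ))) = c.darts (i + ((m + 1 : ℕ) : ZMod k)))
    (hB : ∀ m, n ≤ m → m < k →
      R.faceMap (c.darts (i + ((m + 1 : ℕ) : ZMod k))).symm = (c.darts (i + (m : ℕ))).symm) :
    False := by
  have h1 := chain_sameFace R c i 0 n (by omega) (fun m _ h => hA m h)
  have h2 := (chain_sameFace_rev R c i n k (by omega) hB).symm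
  have h0 := hA 0 (by omega)
  simp only [Nat.cast_zero, add_zero, ZMod.natCast_self, zero_add, Nat.cast_one] at h1 h2 h0
  have hin : i ≠ i + (n : ZMod k) := by
    intro h
    have : (n : ZMod k) = 0 := by linear_combination -h
    rw [ZMod.natCast_eq_zero_iff] at this
    have := Nat.le_of_dvd (by omega) this
    omega
  have hdiff : ¬ R.SameFace (c.darts i) (c.darts i).symm := by
    intro h
    have h3 := hR.1 _ _ (Equiv.Perm.sameCycle_apply_left.2 h) (faceMap_fst R _)
    rw [h0] at h3
    exact cyc_ne_symm hk c _ _ h3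
  have hmem1 : (c.darts i).edge ∈
      R.faceEdges (c.darts i) ∩ R.faceEdges (c.darts i).symm :=
    ⟨⟨_, Equiv.Perm.SameCycle.refl _ _, rfl⟩, ⟨_, Equiv.Perm.SameCycle.refl _ _,
      SimpleGraph.Dart.edge_symm _⟩⟩
  have hmem2 : (c.darts (i + (n : ZMod k))).edge ∈
      R.faceEdges (c.darts i) ∩ R.faceEdges (c.darts i).symm :=
    ⟨⟨_, h1, rfl⟩, ⟨_, h2, SimpleGraph.Dart.edge_symm _⟩⟩
  have hvmem : (c.darts i).fst ∈ R.faceVerts (c.darts i) ∩ R.faceVerts (c.darts i).symm :=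
    ⟨⟨_, Equiv.Perm.SameCycle.refl _ _, rfl⟩, ⟨R.faceMap (c.darts i).symm,
      Equiv.Perm.sameCycle_apply_right.2 (Equiv.Perm.SameCycle.refl _ _), faceMap_fst R _⟩⟩
  rcases hR.2 _ _ hdiff with h | ⟨v, -, h⟩ | ⟨u, w, -, -, h⟩
  · rw [h] at hvmem; exact hvmem
  · rw [h] at hmem1; exact hmem1
  · rw [h] at hmem1 hmem2
    have he : (c.darts i).edge = (c.darts (i + (n : ZMod k))).edge := hmem1.trans hmem2.symm
    rcases (SimpleGraph.dart_edge_eq_iff _ _).1 he with h | h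
    · exact hin (cyc_inj c h)
    · exact cyc_ne_symm hk c _ _ h

theorem interval_structure (hk : 3 ≤ k) (P : ZMod k → Prop) (h1 : ∃ i, P i) (h2 : ∃ i, ¬ P i)
    (hcard : ¬ 2 ≤ Nat.card {i // P i ∧ ¬ P (i + 1)}) :
    ∃ (i : ZMod k) (n : ℕ), 1 ≤ n ∧ n < k ∧
      (∀ m : ℕ, m < n → ¬ P (i + ((m + 1 : ℕ) : ZMod k))) ∧
      (∀ m : ℕ, n ≤ m → m < k → P (i + ((m + 1 : ℕ) : ZMod k))) := by
  haveI : NeZero k := ⟨by omega⟩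
  have huniq : ∀ i j, (P i ∧ ¬ P (i + 1)) → (P j ∧ ¬ P (j + 1)) → i = j := by
    intro i j hi hj
    by_contra hne
    apply hcard
    have : Nontrivial {i // P i ∧ ¬ P (i + 1)} :=
      ⟨⟨i, hi⟩, ⟨j, hj⟩, fun h => hne (congrArg Subtype.val h)⟩
    exact Finite.one_lt_card
  have hstart : ∃ i, P i ∧ ¬ P (i + 1) := by
    by_contra hcon
    push Not at hcon
    obtain ⟨i, hi⟩ := h1
    obtain ⟨j, hj⟩ := h2
    have : ∀ m : ℕ, P (i + (m : ZMod k)) := by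
      intro m
      induction m with
      | zero => simpa using hi
      | succ m ih =>
        have := hcon _ ih
        push_cast
        rwa [← add_assoc]
    apply hj
    have h3 := this (j - i).val
    simpa using h3
  obtain ⟨i, hi, hi1⟩ := hstart
  classical
  have hex : ∃ m : ℕ, P (i + ((m + 1 : ℕ) : ZMod k)) :=
    ⟨k - 1, by rw [Nat.sub_add_cancel (by omega)]; simpa using hi⟩
  refine ⟨i, Nat.find hex, ?_, ?_, fun m hm => Nat.find_min hex hm, ?_⟩
  · rcases Nat.eq_zero_or_pos (Nat.find hex) with h0 | h0
    · have := Nat.find_spec hex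
      rw [h0] at this
      exact absurd (by simpa using this) hi1
    · exact h0
  · have : Nat.find hex ≤ k - 1 :=
      Nat.find_min' hex (by rw [Nat.sub_add_cancel (by omega)]; simpa using hi)
    omega
  · intro m hm
    induction m, hm using Nat.le_induction with
    | base => intro _; exact Nat.find_spec hex
    | succ m hm ih =>
      intro hmk
      have hp := ih (by omega)
      by_contra hnp
      have := huniq i _ ⟨hi, hi1⟩ ⟨hp, by
        rw [add_assoc, ← Nat.cast_succ]; exact hnp⟩
      have h0 : ((m + 1 : ℕ) : ZMod k) = 0 := by linear_combination -this
      rw [ZMod.natCast_eq_zero_iff] at h0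
      have := Nat.le_of_dvd (by omega) h0
      omega

theorem not_both (R : RotationSystem G) (hk : 3 ≤ k) (c : DirCycle G k) (hG : G.IsCubic)
    (i : ZMod k) (h1 : R.faceMap (c.darts (i - 1)) ≠ c.darts i)
    (h2 : R.faceMap (c.darts i).symm ≠ (c.darts (i - 1)).symm) : False := by
  have hab := cyc_ne_symm hk c i (i - 1)
  have hf := pred_fst c i
  rw [faceMap_apply] at h1 h2
  rw [SimpleGraph.Dart.symm_symm] at h2
  generalize c.darts i = a at *
  generalize (c.darts (i - 1)).symm = b at *
  have ha := sigma_ne_self R hf hab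
  have hb := sigma_ne_self R hf.symm hab.symm
  have hs : R.σ a ≠ R.σ b := fun h => hab (R.σ.injective h)
  have hcard := hG a.fst
  let F : {d : G.Dart // d.fst = a.fst} → G.neighborSet a.fst :=
    fun d => ⟨d.1.snd, by
      have h := d.1.adj
      have h' : G.Adj a.fst d.1.snd := by
        simpa only [d.2] using h
      exact h'⟩
  have hF : Function.Injective F := by
    rintro ⟨d, hd⟩ ⟨d', hd'⟩ h
    have h' : d.snd = d'.snd := congrArg Subtype.val h
    apply Subtype.ext
    apply SimpleGraph.Dart.ext
    exact Prod.ext (hd.trans hd'.symm) h'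
  have hinj : Function.Injective
      (![⟨a, rfl⟩, ⟨b, hf.symm⟩, ⟨R.σ a, R.tail_fixed a⟩,
        ⟨R.σ b, (R.tail_fixed b).trans hf.symm⟩] :
        Fin 4 → {d : G.Dart // d.fst = a.fst}) := by
    have := hab.symm
    have := ha.symm
    have := hb.symm
    have := hs.symm
    have := h1.symm
    have := h2.symm
    intro x y hxy
    fin_cases x <;> fin_cases y <;> simp_all
  have := Nat.card_le_card_of_injective _ (hF.comp hinj)
  rw [hcard] at this
  simp at this

end helpers

end RotationSystem

/-- In a polyhedral embedding, an induced directed simple cycle either is a face or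
has at least 3 vertices with a dart leaving to the left (symmetrically for the
reversed cycle and the right side); in the cubic case, if neither orientation is a
face, there are at least 2 left and at least 2 right facial subpaths. -/
theorem induced_cycle_face_or_three_left
    {V : Type*} [Fintype V] [DecidableEq V] {G : SimpleGraph V}
    (R : RotationSystem G) (hR : R.Polyhedral)
    {k : ℕ} (hk : 3 ≤ k) (c : DirCycle G k) (hc : c.Induced) :
    (R.IsFaceOf c ∨ 3 ≤ Nat.card {i : ZMod k // ∃ e : G.Dart, R.IsLeftDartAt c i e}) ∧
    (R.IsReverseFaceOf c ∨ 3 ≤ Nat.card {i : ZMod k // ∃ e : G.Dart, R.IsRightDartAt c i e}) ∧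
    (G.IsCubic → ¬ R.IsFaceOf c → ¬ R.IsReverseFaceOf c →
      2 ≤ Nat.card {i : ZMod k // R.LeftSubpathStart c i} ∧
      2 ≤ Nat.card {i : ZMod k // R.RightSubpathStart c i}) := by
  haveI : NeZero k := ⟨by omega⟩
  have p1 : R.IsFaceOf c ∨ 3 ≤ Nat.card {i : ZMod k // ∃ e : G.Dart, R.IsLeftDartAt c i e} := by
    simp only [RotationSystem.left_iff R hk c]
    by_cases h : R.IsFaceOf c
    · exact Or.inl h
    · exact Or.inr (RotationSystem.part_one R hR hk c hc h)
  have p2 : R.IsReverseFaceOf c ∨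
      3 ≤ Nat.card {i : ZMod k // ∃ e : G.Dart, R.IsRightDartAt c i e} := by
    simp only [RotationSystem.right_iff R hk c]
    by_cases h : R.IsReverseFaceOf c
    · exact Or.inl h
    · exact Or.inr (RotationSystem.part_two R hR hk c hc h)
  refine ⟨p1, p2, fun hG hn1 hn2 => ?_⟩
  have hL : ∃ i, R.faceMap (c.darts (i - 1)) ≠ c.darts i := by
    by_contra hcon
    push Not at hcon
    exact hn1 fun i => by simpa using hcon (i + 1)
  have hRt : ∃ i, R.faceMap (c.darts i).symm ≠ (c.darts (i - 1)).symm := by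
    by_contra hcon
    push Not at hcon
    exact hn2 fun i => by simpa using hcon (i + 1)
  have hnb := RotationSystem.not_both R hk c hG
  have hcast : ∀ (i : ZMod k) (m : ℕ), i + ((m + 1 : ℕ) : ZMod k) - 1 = i + (m : ZMod k) := by
    intro i m
    push_cast
    ring
  constructor
  · by_contra hcard
    unfold RotationSystem.LeftSubpathStart at hcard
    simp only [RotationSystem.left_iff R hk c] at hcard
    obtain ⟨j, hj⟩ := hRt
    obtain ⟨i, n, hn, hnk, hA, hB⟩ := RotationSystem.interval_structure hk
      (fun i => R.faceMap (c.darts (i - 1)) ≠ c.darts i) hL ⟨j, fun h => hnb j h hj⟩ hcard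
    refine RotationSystem.core R hR hk c i n hn hnk (fun m hm => ?_) (fun m h1 h2 => ?_)
    · have := not_not.1 (hA m hm)
      rwa [hcast] at this
    · by_contra hcon
      refine hnb _ (hB m h1 h2) ?_
      rwa [hcast]
  · by_contra hcard
    unfold RotationSystem.RightSubpathStart at hcard
    simp only [RotationSystem.right_iff R hk c] at hcard
    obtain ⟨j, hj⟩ := hL
    obtain ⟨i, n, hn, hnk, hA, hB⟩ := RotationSystem.interval_structure hk
      (fun i => R.faceMap (c.darts i).symm ≠ (c.darts (i - 1)).symm) hRt
      ⟨j, fun h => hnb j hj h⟩ hcard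
    have hshift : ∀ m : ℕ, i + (n : ZMod k) + (m : ZMod k) = i + ((n + m : ℕ) : ZMod k) := by
      intro m
      push_cast
      ring
    refine RotationSystem.core R hR hk c (i + (n : ZMod k)) (k - n) (by omega) (by omega)
      (fun m hm => ?_) (fun m h1 h2 => ?_)
    · rw [hshift, hshift, ← add_assoc]
      by_contra hcon
      refine hnb _ ?_ (hB (n + m) (by omega) (by omega))
      rwa [hcast]
    · obtain ⟨q, rfl⟩ : ∃ q, m = q + (k - n) := ⟨m - (k - n), by omega⟩
      have hq : ∀ q : ℕ, i + (n : ZMod k) + ((q + (k - n) : ℕ) : ZMod k) =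
          i + (q : ZMod k) := by
        intro q
        rw [hshift, show n + (q + (k - n)) = q + k by omega]
        push_cast
        simp
      rw [show q + (k - n) + 1 = (q + 1) + (k - n) by omega, hq, hq]
      have := not_not.1 (hA q (by omega))
      rwa [hcast] at this
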